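/- Let G be a connected unicyclic graph with m edges whose unique cycle C = v₁v₂v₃v₄v₅v₁ has length 5 (girth 5), and suppose G is not isomorphic to the cycle C₅. If there is an index i (mod 5) such that either l(vᵢ) ≤ 2, l(v_{i+2}) ≤ 1 and l(v_{i+1}) = l(v_{i+3}) = l(v_{i+4}) = 0, or l(vᵢ) ≤ 1, l(v_{i+1}) ≤ 1, l(v_{i+2}) ≤ 1 and l(v_{i+3}) = l(v_{i+4}) = 0, then rc(G) = m − 3. -/

import Mathlib

/-- An edge-colored graph is rainbow connected if every two vertices are
joined by a path no two of whose edges have the same color. -/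
def IsRainbowConnected {V α : Type*} (G : SimpleGraph V) (c : Sym2 V → α) : Prop :=
  ∀ u w : V, ∃ p : G.Walk u w, p.IsPath ∧ (p.edges.map c).Nodup

/-- The rainbow connection number: the minimum number of colors in an
edge-coloring making the graph rainbow connected. -/
noncomputable def rc {V : Type*} (G : SimpleGraph V) : ℕ :=
  sInf {k : ℕ | ∃ c : Sym2 V → Fin k, IsRainbowConnected G c}


/-- The set of edges of the cycle `v 0 — v 1 — ⋯ — v (s-1) — v 0`. -/
def cycleEdges {V : Type*} {s : ℕ} (v : ZMod s → V) : Set (Sym2 V) :=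
  {e | ∃ i : ZMod s, e = s(v i, v (i + 1))}

/-- `numLeaves G v i` is `l(vᵢ)`: the number of leaves of the tree `T(vᵢ)`
attached at the cycle vertex `vᵢ`, i.e. the number of vertices, other than the
root `vᵢ`, of degree 1 in the component of `G − E(C)` containing `vᵢ`. -/
noncomputable def numLeaves {V : Type*} [Fintype V] (G : SimpleGraph V) {s : ℕ}
    (v : ZMod s → V) (i : ZMod s) : ℕ :=
  {x : V | x ≠ v i ∧ (G.deleteEdges (cycleEdges v)).Reachable (v i) x ∧
    ((G.deleteEdges (cycleEdges v)).neighborSet x).ncard = 1}.ncard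

open SimpleGraph

/-- The indices `i, i + 1, …, j - 1` of the edges on the arc from `v i` to `v j` of a 5-cycle. -/
def cycleArc (i j : ZMod 5) : Finset (ZMod 5) :=
  Finset.univ.filter fun k => (k - i).val < (j - i).val

theorem mem_cycleArc {i j k : ZMod 5} : k ∈ cycleArc i j ↔ (k - i).val < (j - i).val := by
  simp [cycleArc]

theorem reachable_of_cycleArc {V : Type*} {K : SimpleGraph V} {v : ZMod 5 → V} {i j : ZMod 5}
    (h : ∀ k ∈ cycleArc i j, K.Adj (v k) (v (k + 1))) : K.Reachable (v i) (v j) := by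
  have key : ∀ n : ℕ, n ≤ (j - i).val → K.Reachable (v i) (v (i + n)) := by
    intro n
    induction n with
    | zero => intro _; simp
    | succ n ih =>
      intro hn
      refine (ih (by omega)).trans ?_
      have hlt : n < 5 := by have := ZMod.val_lt (j - i); omega
      have := h (i + n) (by
        rw [mem_cycleArc, add_sub_cancel_left, ZMod.val_natCast_of_lt hlt]; omega)
      rw [Nat.cast_succ, ← add_assoc]
      exact this.reachable
  have := key _ le_rfl
  rwa [ZMod.natCast_zmod_val, add_sub_cancel] at this

theorem cycleEdge_injective {V : Type*} {v : ZMod 5 → V} (hinj : Function.Injective v) :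
    Function.Injective fun k => s(v k, v (k + 1)) := by
  intro k k' h
  simp only [Sym2.eq_iff, hinj.eq_iff] at h
  revert k k'
  decide

theorem mem_cycleEdges {V : Type*} (v : ZMod 5 → V) (k : ZMod 5) :
    s(v k, v (k + 1)) ∈ cycleEdges v := ⟨k, rfl⟩

theorem ncard_edgeSet_deleteEdges_cycleEdges {V : Type*} [Fintype V] {G : SimpleGraph V}
    {v : ZMod 5 → V} (hinj : Function.Injective v) (hadj : ∀ i, G.Adj (v i) (v (i + 1))) :
    (G.deleteEdges (cycleEdges v)).edgeSet.ncard + 5 = G.edgeSet.ncard := by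
  have hC : (cycleEdges v).ncard = 5 := by
    have : cycleEdges v = Set.range fun k => s(v k, v (k + 1)) := by
      ext e; simp [cycleEdges, eq_comm]
    rw [this, ← Set.image_univ, Set.ncard_image_of_injective _ (cycleEdge_injective hinj),
      Set.ncard_univ, Nat.card_zmod]
  have hsub : cycleEdges v ⊆ G.edgeSet := by
    rintro _ ⟨k, rfl⟩; exact hadj k
  have := Set.ncard_sdiff_add_ncard_of_subset hsub
  rwa [hC, ← edgeSet_deleteEdges] at this

/-- Deleting one edge of the cycle of a unicyclic graph leaves a tree. -/
theorem isTree_deleteEdges_cycleEdge {V : Type*} [Fintype V] {G : SimpleGraph V}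
    (hconn : G.Connected) (huni : G.edgeSet.ncard = Fintype.card V)
    {v : ZMod 5 → V} (hinj : Function.Injective v) (hadj : ∀ i, G.Adj (v i) (v (i + 1)))
    (k : ZMod 5) : (G.deleteEdges {s(v k, v (k + 1))}).IsTree := by
  refine isTree_iff_connected_and_card.2
    ⟨hconn.connected_delete_edge_of_not_isBridge ?_, ?_⟩
  · rw [isBridge_iff, not_not]
    refine (reachable_of_cycleArc fun l hl => ?_).symm
    refine deleteEdges_adj.2 ⟨hadj l, fun h => ?_⟩
    have := cycleEdge_injective hinj h
    subst this
    simp [mem_cycleArc] at hl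
  · rw [Nat.card_eq_fintype_card (α := V), ← huni, edgeSet_deleteEdges, Nat.card_coe_set_eq]
    exact Set.ncard_sdiff_singleton_add_one (hadj k)

/-- The graph left after deleting the cycle of a unicyclic graph is a forest in which every vertex
lies in the tree of exactly one cycle vertex. -/
theorem exists_root {V : Type*} [Fintype V] {G : SimpleGraph V}
    (hconn : G.Connected) (huni : G.edgeSet.ncard = Fintype.card V)
    {v : ZMod 5 → V} (hinj : Function.Injective v) (hadj : ∀ i, G.Adj (v i) (v (i + 1))) :
    (G.deleteEdges (cycleEdges v)).IsAcyclic ∧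
      ∃ r : V → ZMod 5, ∀ x j, (G.deleteEdges (cycleEdges v)).Reachable (v j) x ↔ r x = j := by
  have hle (k : ZMod 5) : G.deleteEdges (cycleEdges v) ≤ G.deleteEdges {s(v k, v (k + 1))} :=
    G.deleteEdges_anti (by simpa using mem_cycleEdges v k)
  refine ⟨(isTree_deleteEdges_cycleEdge hconn huni hinj hadj 0).isAcyclic.anti (hle 0), ?_⟩
  have hex (x : V) : ∃ j, (G.deleteEdges (cycleEdges v)).Reachable (v j) x := by
    obtain ⟨p⟩ := hconn x (v 0)
    have h0 : ∃ j, (G.deleteEdges (cycleEdges v)).Reachable (v j) (v 0) := ⟨0, .rfl⟩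
    revert h0
    generalize v 0 = y at p
    intro hy
    induction p with
    | nil => exact hy
    | @cons x x' _ h p ih =>
      obtain ⟨j, hj⟩ := ih hy
      by_cases hC : s(x, x') ∈ cycleEdges v
      · obtain ⟨k, hk⟩ := hC
        obtain ⟨rfl, -⟩ | ⟨rfl, -⟩ := Sym2.eq_iff.1 hk
        exacts [⟨_, .rfl⟩, ⟨_, .rfl⟩]
      · exact ⟨j, hj.trans (deleteEdges_adj.2 ⟨h, hC⟩ : Adj _ _ _).symm.reachable⟩
  have huniq (i j : ZMod 5) (h : (G.deleteEdges (cycleEdges v)).Reachable (v i) (v j)) :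
      i = j := by
    by_contra hij
    have hT := (isTree_deleteEdges_cycleEdge hconn huni hinj hadj j).isAcyclic
    have hne : s(v i, v (i + 1)) ≠ s(v j, v (j + 1)) :=
      (cycleEdge_injective hinj).ne hij
    have hbr := isAcyclic_iff_forall_isBridge.1 hT
      (show s(v i, v (i + 1)) ∈ _ from deleteEdges_adj.2 ⟨hadj i, hne⟩)
    refine isBridge_iff.1 hbr ((h.mono ?_).trans (reachable_of_cycleArc fun l hl => ?_).symm)
    · rw [deleteEdges_deleteEdges]
      refine G.deleteEdges_anti ?_
      rintro e (rfl | rfl)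
      exacts [mem_cycleEdges v j, mem_cycleEdges v i]
    · rw [deleteEdges_deleteEdges]
      refine deleteEdges_adj.2 ⟨hadj l, ?_⟩
      have hlj : l ≠ j ∧ l ≠ i := by
        clear hT hne hbr h
        revert i j l
        decide
      rintro (h | h)
      exacts [hlj.1 (cycleEdge_injective hinj h), hlj.2 (cycleEdge_injective hinj h)]
  choose r hr using hex
  exact ⟨r, fun x j => ⟨fun h => huniq _ _ ((hr x).trans h.symm), fun h => h ▸ hr x⟩⟩

/-- Beyond any edge of a finite forest, as seen from `a`, there is a leaf. -/
theorem SimpleGraph.IsAcyclic.exists_leaf_beyond {V : Type*} [Finite V] {H : SimpleGraph V}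
    (hH : H.IsAcyclic) {a z₀ : V} {b : Sym2 V} (h₀ : H.Reachable a z₀)
    (hb₀ : ¬ (H.deleteEdges {b}).Reachable a z₀) :
    ∃ z, z ≠ a ∧ H.Reachable a z ∧ ¬ (H.deleteEdges {b}).Reachable a z ∧
      (H.neighborSet z).ncard = 1 := by
  obtain ⟨z, ⟨hz, hbz⟩, hmax⟩ := Set.exists_max_image
    {z | H.Reachable a z ∧ ¬ (H.deleteEdges {b}).Reachable a z} (H.dist a) (Set.toFinite _)
    ⟨z₀, h₀, hb₀⟩
  have hza : z ≠ a := by rintro rfl; exact hbz .rfl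
  refine ⟨z, hza, hz, hbz, ?_⟩
  obtain ⟨p, hp, hpl⟩ := hz.exists_path_of_dist
  have hbp := p.mem_edges_of_not_reachable_deleteEdges hbz
  have hnil : ¬ p.Nil := fun h => hza h.eq.symm
  rw [Set.ncard_eq_one]
  refine ⟨p.penultimate, Set.eq_singleton_iff_unique_mem.2
    ⟨(p.adj_penultimate hnil).symm, fun y hy => ?_⟩⟩
  replace hy : H.Adj z y := hy
  by_contra hne
  have hys : y ∉ p.support := fun h => hne (hH.eq_penultimate_of_adj_end hp hy h)
  have huniq (q : H.Walk a y) (hq : q.IsPath) : q = p.concat hy :=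
    congrArg Subtype.val ((hH.subsingleton_path a y).elim ⟨q, hq⟩ ⟨_, hp.concat hys hy⟩)
  have hay : H.Reachable a y := ⟨p.concat hy⟩
  have hby : ¬ (H.deleteEdges {b}).Reachable a y := by
    intro h
    obtain ⟨q, hq⟩ := h.exists_isPath
    have h1 := huniq (q.map (.ofLE (H.deleteEdges_le _))) (hq.mapLe _)
    have h2 : b ∈ (q.map (.ofLE (H.deleteEdges_le _))).edges := by
      rw [h1, Walk.edges_concat]; simp [hbp]
    have h3 : b ∈ q.edges := by simpa using h2
    have := q.edges_subset_edgeSet h3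
    simp at this
  obtain ⟨q, hq, hql⟩ := hay.exists_path_of_dist
  have := hmax y ⟨hay, hby⟩
  rw [← hql, huniq q hq, Walk.length_concat, hpl] at this
  omega

/-- A unicyclic graph that consists of its 5-cycle only is isomorphic to `cycleGraph 5`. -/
theorem nonempty_iso_cycleGraph_of_edgeSet_eq_empty {V : Type*} {G : SimpleGraph V}
    {v : ZMod 5 → V} (hinj : Function.Injective v) (hadj : ∀ i, G.Adj (v i) (v (i + 1)))
    {r : V → ZMod 5} (hr : ∀ x j, (G.deleteEdges (cycleEdges v)).Reachable (v j) x ↔ r x = j)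
    (hH : (G.deleteEdges (cycleEdges v)).edgeSet = ∅) : Nonempty (G ≃g cycleGraph 5) := by
  rw [edgeSet_eq_empty] at hH
  have hsurj : Function.Surjective v := fun x => by
    refine ⟨r x, ?_⟩
    have := (hr x (r x)).2 rfl
    rwa [hH, reachable_bot] at this
  have key (i j : ZMod 5) : G.Adj (v i) (v j) ↔ i - j = 1 ∨ j - i = 1 := by
    constructor
    · intro h
      have hC : s(v i, v j) ∈ cycleEdges v := by
        by_contra hC
        have : (G.deleteEdges (cycleEdges v)).Adj (v i) (v j) := deleteEdges_adj.2 ⟨h, hC⟩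
        simp [hH] at this
      obtain ⟨k, hk⟩ := hC
      simp only [Sym2.eq_iff, hinj.eq_iff] at hk
      obtain ⟨rfl, rfl⟩ | ⟨rfl, rfl⟩ := hk <;> simp
    · rintro (h | h)
      · obtain rfl := sub_eq_iff_eq_add'.1 h
        exact (hadj j).symm
      · obtain rfl := sub_eq_iff_eq_add'.1 h
        exact hadj i
  let e : Fin 5 ≃ V := Equiv.ofBijective v ⟨hinj, hsurj⟩
  have f : cycleGraph 5 ≃g G := ⟨e, fun {i j} => (key i j).trans cycleGraph_adj.symm⟩
  exact ⟨f.symm⟩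

/-- A walk whose edges have distinct colors can be shortened to a rainbow path. -/
theorem SimpleGraph.Walk.exists_rainbow_path {V α : Type*} {G : SimpleGraph V} {c : Sym2 V → α}
    {u w : V} (p : G.Walk u w) (h : Set.InjOn c {e | e ∈ p.edges}) :
    ∃ q : G.Walk u w, q.IsPath ∧ (q.edges.map c).Nodup := by
  classical
  refine ⟨p.bypass, p.bypass_isPath, p.bypass_isPath.isTrail.edges_nodup.map_on ?_⟩
  exact fun e h₁ e' h₂ => h (p.edges_bypass_subset_edges h₁) (p.edges_bypass_subset_edges h₂)

/-- Two vertices of a 5-cycle are joined by a walk along at most two consecutive edges, none of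
them opposite to one of these vertices. -/
theorem exists_short_walk {V : Type*} {G : SimpleGraph V} {v : ZMod 5 → V}
    (hadj : ∀ i, G.Adj (v i) (v (i + 1))) (i j : ZMod 5) :
    ∃ (q : G.Walk (v i) (v j)) (l : ZMod 5), ∀ e ∈ q.edges,
      ∃ k, e = s(v k, v (k + 1)) ∧ k ≠ i + 2 ∧ k ≠ j + 2 ∧ (k = l ∨ k = l + 1) := by
  have h1 (i : ZMod 5) : i ≠ i + 2 ∧ i ≠ i + 1 + 2 ∧ i ≠ i + 1 + 1 + 2 ∧
      i + 1 ≠ i + 2 ∧ i + 1 ≠ i + 1 + 1 + 2 := by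
    revert i; decide
  have key (i d : ZMod 5) (hd : d = i ∨ d = i + 1 ∨ d = i + 1 + 1) :
      ∃ (q : G.Walk (v i) (v d)) (l : ZMod 5), ∀ e ∈ q.edges,
        ∃ k, e = s(v k, v (k + 1)) ∧ k ≠ i + 2 ∧ k ≠ d + 2 ∧ (k = l ∨ k = l + 1) := by
    obtain ⟨h0, h1, h2, h3, h4⟩ := h1 i
    obtain rfl | rfl | rfl := hd
    · exact ⟨.nil, 0, by simp⟩
    · refine ⟨.cons (hadj i) .nil, i, ?_⟩
      simp only [Walk.edges_cons, Walk.edges_nil, List.mem_singleton, forall_eq]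
      exact ⟨i, rfl, h0, h1, .inl rfl⟩
    · refine ⟨.cons (hadj i) (.cons (hadj (i + 1)) .nil), i, ?_⟩
      simp only [Walk.edges_cons, Walk.edges_nil, List.mem_cons, List.not_mem_nil, or_false,
        forall_eq_or_imp, forall_eq]
      exact ⟨⟨i, rfl, h0, h2, .inl rfl⟩, ⟨i + 1, rfl, h3, h4, .inr rfl⟩⟩
  have hij : (j = i ∨ j = i + 1 ∨ j = i + 1 + 1) ∨ (i = j ∨ i = j + 1 ∨ i = j + 1 + 1) := by
    revert i j; decide
  obtain h | h := hij
  · exact key i j h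
  · obtain ⟨q, l, hq⟩ := key j i h
    refine ⟨q.reverse, l, fun e he => ?_⟩
    obtain ⟨k, hk, ha, hb, hc⟩ := hq e (by simpa using he)
    exact ⟨k, hk, hb, ha, hc⟩

/-- A unicyclic graph of girth 5 that has an edge `b` outside its cycle can be rainbow connected
by giving different colors to the edges outside the cycle, the color of `b` to the edge of
the cycle opposite to the root of `b`, and two new colors alternately to the rest of the cycle. -/
theorem exists_isRainbowConnected {V : Type*} {G : SimpleGraph V}
    {v : ZMod 5 → V} (hinj : Function.Injective v) (hadj : ∀ i, G.Adj (v i) (v (i + 1)))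
    {r : V → ZMod 5} (hr : ∀ x j, (G.deleteEdges (cycleEdges v)).Reachable (v j) x ↔ r x = j)
    (b : (G.deleteEdges (cycleEdges v)).edgeSet) :
    ∃ c : Sym2 V → (G.deleteEdges (cycleEdges v)).edgeSet ⊕ Bool, IsRainbowConnected G c := by
  classical
  set H := G.deleteEdges (cycleEdges v) with hH
  obtain ⟨j, hj⟩ : ∃ j, ∀ x ∈ b.1, r x = j := by
    obtain ⟨⟨x, y⟩, hb⟩ := b
    have hxy : H.Adj x y := hb
    have hx := (hr x (r x)).2 rfl
    refine ⟨r x, fun z hz => ?_⟩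
    obtain rfl | rfl := Sym2.mem_iff.1 hz
    · rfl
    · exact (hr _ _).1 (hx.trans hxy.reachable)
  let col : ZMod 5 → H.edgeSet ⊕ Bool := fun k =>
    if k = j + 2 then .inl b else .inr (decide (k = j + 4 ∨ k = j + 1))
  have hcol_succ (k : ZMod 5) : col k ≠ col (k + 1) := by
    have : ¬ (k = j + 2 ∧ k + 1 = j + 2) ∧ (k ≠ j + 2 → k + 1 ≠ j + 2 →
        decide (k = j + 4 ∨ k = j + 1) ≠ decide (k + 1 = j + 4 ∨ k + 1 = j + 1)) := by
      clear hj col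
      revert j k
      decide
    simp only [col]
    split_ifs <;> simp_all
  have hcol_inl (k : ZMod 5) (e : H.edgeSet) (h : col k = .inl e) : e = b ∧ k = j + 2 := by
    simp only [col] at h
    split_ifs at h with hk
    exact ⟨(Sum.inl.inj h).symm, hk⟩
  let c : Sym2 V → H.edgeSet ⊕ Bool := fun e =>
    if h : e ∈ H.edgeSet then .inl ⟨e, h⟩
    else Function.extend (fun k => s(v k, v (k + 1))) col (fun _ => .inr false) e
  have hc_tree (e : H.edgeSet) : c e = .inl e := by simp [c]
  have hc_cycle (k : ZMod 5) : c s(v k, v (k + 1)) = col k := by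
    have : s(v k, v (k + 1)) ∉ H.edgeSet := by
      rw [hH, edgeSet_deleteEdges]; exact fun h => h.2 (mem_cycleEdges v k)
    simp only [c, dif_neg this]
    exact (cycleEdge_injective hinj).extend_apply col _ k
  refine ⟨c, fun u w => ?_⟩
  have hroot {i : ZMod 5} {x : V} (p : H.Walk (v i) x) (hb : b.1 ∈ p.edges) : i = j := by
    obtain ⟨y, hy⟩ : ∃ y, y ∈ b.1 := ⟨b.1.out.1, Sym2.out_fst_mem _⟩
    have := p.mem_support_of_mem_edges hb hy
    rw [← hj y hy]
    exact ((hr y i).1 ⟨p.takeUntil y this⟩).symm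
  obtain ⟨pu⟩ := (hr u (r u)).2 rfl
  obtain ⟨pw⟩ := (hr w (r w)).2 rfl
  obtain ⟨q, l, hq⟩ := exists_short_walk hadj (r u) (r w)
  let F := Hom.ofLE (G.deleteEdges_le (cycleEdges v))
  refine (((pu.map F).reverse.append q).append (pw.map F)).exists_rainbow_path ?_
  have hmem {e : Sym2 V} (he : e ∈ (((pu.map F).reverse.append q).append (pw.map F)).edges) :
      (∃ e' : H.edgeSet, e = e' ∧ (e' = b → r u = j ∨ r w = j)) ∨
      (∃ k, e = s(v k, v (k + 1)) ∧ k ≠ r u + 2 ∧ k ≠ r w + 2 ∧ (k = l ∨ k = l + 1)) := by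
    have hmap {x y : V} (p : H.Walk x y) : (p.map F).edges = p.edges := by
      simp [F]
    simp only [Walk.edges_append, Walk.edges_reverse, List.mem_append, List.mem_reverse] at he
    rw [hmap pu, hmap pw] at he
    obtain (he | he) | he := he
    · exact .inl ⟨⟨e, pu.edges_subset_edgeSet he⟩, rfl, fun h => .inl (hroot pu (h ▸ he))⟩
    · exact .inr (hq e he)
    · exact .inl ⟨⟨e, pw.edges_subset_edgeSet he⟩, rfl, fun h => .inr (hroot pw (h ▸ he))⟩
  have hmix {e : H.edgeSet} {k : ZMod 5} (he : e = b → r u = j ∨ r w = j) (hku : k ≠ r u + 2)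
      (hkw : k ≠ r w + 2) (h : col k = .inl e) : False := by
    obtain ⟨he', hk⟩ := hcol_inl k e h
    obtain h | h := he he'
    exacts [hku (h ▸ hk), hkw (h ▸ hk)]
  intro e he e' he' h
  obtain ⟨f, rfl, hf⟩ | ⟨k, rfl, hku, hkw, hk⟩ := hmem he <;>
    obtain ⟨f', rfl, hf'⟩ | ⟨k', rfl, hku', hkw', hk'⟩ := hmem he'
  · rw [hc_tree, hc_tree] at h
    rw [Sum.inl.inj h]
  · rw [hc_tree, hc_cycle] at h
    exact (hmix hf hku' hkw' h.symm).elim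
  · rw [hc_tree, hc_cycle] at h
    exact (hmix hf' hku hkw h).elim
  · rw [hc_cycle, hc_cycle] at h
    obtain rfl | rfl := hk <;> obtain rfl | rfl := hk'
    · rfl
    · exact (hcol_succ _ h).elim
    · exact (hcol_succ _ h.symm).elim
    · rfl

/-- After deleting an edge of a connected graph every vertex is still joined to an end of it. -/
theorem SimpleGraph.Connected.reachable_deleteEdges_or {V : Type*} {G : SimpleGraph V}
    (hG : G.Connected) (x y w : V) :
    (G.deleteEdges {s(x, y)}).Reachable w x ∨ (G.deleteEdges {s(x, y)}).Reachable w y := by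
  have key {w x' : V} (p : G.Walk w x') (hx' : x' = x) :
      (G.deleteEdges {s(x, y)}).Reachable w x ∨ (G.deleteEdges {s(x, y)}).Reachable w y := by
    induction p with
    | nil => exact .inl (hx' ▸ .rfl)
    | @cons w w' _ h p ih =>
      by_cases he : s(w, w') = s(x, y)
      · obtain ⟨rfl, -⟩ | ⟨rfl, -⟩ := Sym2.eq_iff.1 he
        exacts [.inl .rfl, .inr .rfl]
      · have hw : (G.deleteEdges {s(x, y)}).Reachable w w' :=
          (show Adj _ _ _ from deleteEdges_adj.2 ⟨h, he⟩).reachable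
        exact (ih hx').imp hw.trans hw.trans
  obtain ⟨p⟩ := hG w x
  exact key p rfl

/-- Any two bridges of a connected graph separate a common pair of vertices. -/
theorem SimpleGraph.Connected.exists_forall_walk_mem_edges {V : Type*} {G : SimpleGraph V}
    (hG : G.Connected) {b b' : Sym2 V} (hb : b ∈ G.edgeSet) (hb' : b' ∈ G.edgeSet) (hne : b ≠ b')
    (hbr : G.IsBridge b) (hbr' : G.IsBridge b') :
    ∃ u w, ∀ p : G.Walk u w, b ∈ p.edges ∧ b' ∈ p.edges := by
  suffices h : ∃ u w, ¬ (G.deleteEdges {b}).Reachable u w ∧ ¬ (G.deleteEdges {b'}).Reachable u w by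
    obtain ⟨u, w, h, h'⟩ := h
    exact ⟨u, w, fun p => ⟨p.mem_edges_of_not_reachable_deleteEdges h,
      p.mem_edges_of_not_reachable_deleteEdges h'⟩⟩
  have key (x y z t : V) (hxy : G.Adj x y) (hzt : G.Adj z t) (hne : s(x, y) ≠ s(z, t))
      (hbr : ¬ (G.deleteEdges {s(x, y)}).Reachable x y)
      (hbr' : ¬ (G.deleteEdges {s(z, t)}).Reachable z t)
      (h : (G.deleteEdges {s(x, y)}).Reachable z x)
      (h' : (G.deleteEdges {s(z, t)}).Reachable x z) :
      ∃ u w, ¬ (G.deleteEdges {s(x, y)}).Reachable u w ∧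
        ¬ (G.deleteEdges {s(z, t)}).Reachable u w := by
    have h1 : (G.deleteEdges {s(z, t)}).Adj x y := deleteEdges_adj.2 ⟨hxy, hne⟩
    have h2 : (G.deleteEdges {s(x, y)}).Adj z t := deleteEdges_adj.2 ⟨hzt, hne.symm⟩
    exact ⟨y, t, fun h3 => hbr (h.symm.trans (h2.reachable.trans h3.symm)),
      fun h3 => hbr' (h'.symm.trans (h1.reachable.trans h3))⟩
  induction b with | h x y =>
  induction b' with | h z t =>
  have aux (x y : V) (hxy : G.Adj x y) (hne : s(x, y) ≠ s(z, t))
      (hbr : ¬ (G.deleteEdges {s(x, y)}).Reachable x y)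
      (h : (G.deleteEdges {s(x, y)}).Reachable z x) :
      ∃ u w, ¬ (G.deleteEdges {s(x, y)}).Reachable u w ∧
        ¬ (G.deleteEdges {s(z, t)}).Reachable u w := by
    obtain h' | h' := hG.reachable_deleteEdges_or z t x
    · exact key x y z t hxy hb' hne hbr hbr' h h'
    · have hzt : (G.deleteEdges {s(x, y)}).Adj z t := deleteEdges_adj.2 ⟨hb', hne.symm⟩
      have := key x y t z hxy (Adj.symm hb') (by rwa [Sym2.eq_swap (a := t)]) hbr
      rw [Sym2.eq_swap (a := t)] at this
      exact this (fun h => hbr' h.symm) (hzt.reachable.symm.trans h) h'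
  obtain h | h := hG.reachable_deleteEdges_or x y z
  · exact aux x y hb hne hbr h
  · have := aux y x (Adj.symm hb) (by rwa [Sym2.eq_swap])
    rw [Sym2.eq_swap (a := y)] at this
    exact this (fun h => hbr h.symm) h

/-- A walk that starts beyond the edge `b` of the tree at `v i` and avoids `b` stays beyond `b`. -/
theorem reachable_of_notMem_edges {V : Type*} {G : SimpleGraph V} {v : ZMod 5 → V}
    {r : V → ZMod 5} (hr : ∀ x j, (G.deleteEdges (cycleEdges v)).Reachable (v j) x ↔ r x = j)
    {i : ZMod 5} {b : Sym2 V} {x y : V} (p : G.Walk x y) (hx : r x = i)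
    (hbx : ¬ ((G.deleteEdges (cycleEdges v)).deleteEdges {b}).Reachable (v i) x)
    (hp : b ∉ p.edges) : ((G.deleteEdges (cycleEdges v)).deleteEdges {b}).Reachable x y := by
  induction p with
  | nil => exact .rfl
  | @cons x x' _ h p ih =>
    rw [Walk.edges_cons, List.mem_cons, not_or] at hp
    by_cases hC : s(x, x') ∈ cycleEdges v
    · obtain ⟨k, hk⟩ := hC
      refine (hbx ?_).elim
      obtain ⟨rfl, -⟩ | ⟨rfl, -⟩ := Sym2.eq_iff.1 hk <;> rw [← hx, (hr _ _).1 .rfl]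
    · have hadj : (G.deleteEdges (cycleEdges v)).Adj x x' := deleteEdges_adj.2 ⟨h, hC⟩
      have hadj' : ((G.deleteEdges (cycleEdges v)).deleteEdges {b}).Adj x x' :=
        deleteEdges_adj.2 ⟨hadj, fun h => hp.1 h.symm⟩
      refine hadj'.reachable.trans (ih ?_ (fun h => hbx (h.trans hadj'.symm.reachable)) hp.2)
      exact (hr x' i).1 (((hr x i).2 hx).trans hadj.reachable)

/-- A walk that starts beyond the edge `b` of the tree at `v i` and ends at `v i` or in another
tree uses `b`. -/
theorem mem_edges_of_not_reachable {V : Type*} {G : SimpleGraph V} {v : ZMod 5 → V}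
    {r : V → ZMod 5} (hr : ∀ x j, (G.deleteEdges (cycleEdges v)).Reachable (v j) x ↔ r x = j)
    {b : Sym2 V} {x y : V} (p : G.Walk x y)
    (hbx : ¬ ((G.deleteEdges (cycleEdges v)).deleteEdges {b}).Reachable (v (r x)) x)
    (hy : y = v (r x) ∨ r y ≠ r x) : b ∈ p.edges := by
  by_contra hp
  have h := reachable_of_notMem_edges hr p rfl hbx hp
  obtain rfl | hy := hy
  · exact hbx h.symm
  · exact hy ((hr y _).1 (((hr x _).2 rfl).trans (h.mono (deleteEdges_le _))))

/-- One end of an edge of a tree attached to the cycle lies beyond that edge. -/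
theorem exists_mem_not_reachable {V : Type*} {G : SimpleGraph V} {v : ZMod 5 → V}
    {r : V → ZMod 5} (hr : ∀ x j, (G.deleteEdges (cycleEdges v)).Reachable (v j) x ↔ r x = j)
    (hH : (G.deleteEdges (cycleEdges v)).IsAcyclic)
    {x y : V} (hb : (G.deleteEdges (cycleEdges v)).Adj x y) :
    ∃ z, (z = x ∨ z = y) ∧
      ¬ ((G.deleteEdges (cycleEdges v)).deleteEdges {s(x, y)}).Reachable (v (r z)) z := by
  by_contra! h
  have hxy : r y = r x := (hr _ _).1 (((hr _ _).2 rfl).trans hb.reachable)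
  have hy := h y (.inr rfl)
  rw [hxy] at hy
  exact isBridge_iff.1 (isAcyclic_iff_forall_adj_isBridge.1 hH hb)
    ((h x (.inl rfl)).symm.trans hy)

/-- The edges outside the cycle are bridges. -/
theorem isBridge_of_mem_edgeSet {V : Type*} {G : SimpleGraph V} {v : ZMod 5 → V}
    {r : V → ZMod 5} (hr : ∀ x j, (G.deleteEdges (cycleEdges v)).Reachable (v j) x ↔ r x = j)
    (hH : (G.deleteEdges (cycleEdges v)).IsAcyclic)
    {b : Sym2 V} (hb : b ∈ (G.deleteEdges (cycleEdges v)).edgeSet) : G.IsBridge b := by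
  have hbr := isAcyclic_iff_forall_isBridge.1 hH hb
  induction b with | h x y =>
  rw [isBridge_iff_forall_walk_mem_edges]
  intro p
  by_contra hp
  rw [isBridge_iff] at hbr
  obtain ⟨z, rfl | rfl, hz⟩ := exists_mem_not_reachable hr hH hb
  · exact hbr (reachable_of_notMem_edges hr p rfl hz hp)
  · exact hbr (reachable_of_notMem_edges hr p.reverse rfl hz (by simpa using hp)).symm

/-- Beyond every edge outside the cycle there is a leaf. -/
theorem exists_leaf {V : Type*} [Finite V] {G : SimpleGraph V} {v : ZMod 5 → V}
    {r : V → ZMod 5} (hr : ∀ x j, (G.deleteEdges (cycleEdges v)).Reachable (v j) x ↔ r x = j)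
    (hH : (G.deleteEdges (cycleEdges v)).IsAcyclic)
    {b : Sym2 V} (hb : b ∈ (G.deleteEdges (cycleEdges v)).edgeSet) :
    ∃ z, z ≠ v (r z) ∧ ((G.deleteEdges (cycleEdges v)).neighborSet z).ncard = 1 ∧
      ¬ ((G.deleteEdges (cycleEdges v)).deleteEdges {b}).Reachable (v (r z)) z := by
  induction b with | h x y =>
  obtain ⟨z, -, hz⟩ := exists_mem_not_reachable hr hH hb
  obtain ⟨t, ht, hrt, hbt, hl⟩ := hH.exists_leaf_beyond ((hr z _).2 rfl) hz
  obtain h := (hr t _).1 hrt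
  rw [← h] at ht hbt
  exact ⟨t, ht, hl, hbt⟩

/-- A walk runs along one of the two arcs of the cycle between the roots of its ends. -/
theorem SimpleGraph.Walk.exists_cycleArc {V : Type*} {G : SimpleGraph V} {v : ZMod 5 → V}
    {r : V → ZMod 5} (hr : ∀ x j, (G.deleteEdges (cycleEdges v)).Reachable (v j) x ↔ r x = j)
    {x y : V} (p : G.Walk x y) :
    ∃ A, (A = cycleArc (r x) (r y) ∨ A = cycleArc (r y) (r x)) ∧
      ∀ k ∈ A, s(v k, v (k + 1)) ∈ p.edges := by
  have hrv (j : ZMod 5) : r (v j) = j := (hr _ _).1 .rfl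
  have step (k j : ZMod 5) :
      (∀ A, A = cycleArc (k + 1) j ∨ A = cycleArc j (k + 1) →
        cycleArc k j ⊆ insert k A ∨ cycleArc j k ⊆ insert k A) ∧
      (∀ A, A = cycleArc k j ∨ A = cycleArc j k →
        cycleArc (k + 1) j ⊆ insert k A ∨ cycleArc j (k + 1) ⊆ insert k A) := by
    simp only [forall_eq_or_imp, forall_eq]
    revert k j
    decide
  induction p with
  | @nil x => exact ⟨∅, .inl (by simp [cycleArc]), by simp⟩
  | @cons x x' y h p ih =>
    obtain ⟨A, hA, hAp⟩ := ih
    simp only [Walk.edges_cons, List.mem_cons]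
    by_cases hC : s(x, x') ∈ cycleEdges v
    · obtain ⟨k, hk⟩ := hC
      have hsub {B : Finset (ZMod 5)} (hB : B ⊆ insert k A) (l : ZMod 5) (hl : l ∈ B) :
          s(v l, v (l + 1)) = s(x, x') ∨ s(v l, v (l + 1)) ∈ p.edges := by
        obtain rfl | hl := Finset.mem_insert.1 (hB hl)
        exacts [.inl hk.symm, .inr (hAp l hl)]
      obtain ⟨rfl, rfl⟩ | ⟨rfl, rfl⟩ := Sym2.eq_iff.1 hk <;> rw [hrv] at hA ⊢
      · obtain h | h := (step k (r y)).1 A hA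
        exacts [⟨_, .inl rfl, hsub h⟩, ⟨_, .inr rfl, hsub h⟩]
      · obtain h | h := (step k (r y)).2 A hA
        exacts [⟨_, .inl rfl, hsub h⟩, ⟨_, .inr rfl, hsub h⟩]
    · have hadj : (G.deleteEdges (cycleEdges v)).Adj x x' := deleteEdges_adj.2 ⟨h, hC⟩
      have hx : r x' = r x := (hr _ _).1 (((hr x _).2 rfl).trans hadj.reachable)
      exact ⟨A, hx ▸ hA, fun k hk => .inr (hAp k hk)⟩

/-- Any two edges of a 5-cycle can be separated by the two arcs from `i` to some `j`. -/
theorem exists_hit_cycleArcs : ∀ i e e' : ZMod 5, e ≠ e' →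
    ∃ j, (e ∈ cycleArc i j ∨ e' ∈ cycleArc i j) ∧ (e ∈ cycleArc j i ∨ e' ∈ cycleArc j i) := by
  decide +kernel

set_option synthInstance.maxHeartbeats 400000 in
set_option synthInstance.maxSize 2000 in
theorem exists_repeated_on_cycleArcs : ∀ i e g₁ g₂ g₃ : ZMod 5, e ≠ g₁ → e ≠ g₂ →
    e ≠ g₃ → g₁ ≠ g₂ → g₁ ≠ g₃ → g₂ ≠ g₃ →
    ∃ j, ∀ A ∈ [cycleArc i j, cycleArc j i],
      e ∈ A ∨ g₁ ∈ A ∧ g₂ ∈ A ∨ g₁ ∈ A ∧ g₃ ∈ A ∨ g₂ ∈ A ∧ g₃ ∈ A := by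
  decide +kernel

set_option synthInstance.maxHeartbeats 400000 in
set_option synthInstance.maxSize 2000 in
theorem cycleArcs_of_two_one : ∀ f₁ f₂ f₃ g₁ g₂ : ZMod 5, [f₁, f₂, f₃, g₁, g₂].Nodup → ∀ i,
    (∀ A ∈ [cycleArc i (i + 2), cycleArc (i + 2) i], f₁ ∈ A ∨ f₃ ∈ A ∨ g₁ ∈ A ∧ g₂ ∈ A) ∨
    (∀ A ∈ [cycleArc i (i + 2), cycleArc (i + 2) i], f₂ ∈ A ∨ f₃ ∈ A ∨ g₁ ∈ A ∧ g₂ ∈ A) := by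
  decide +kernel

set_option synthInstance.maxHeartbeats 400000 in
set_option synthInstance.maxSize 2000 in
theorem cycleArcs_of_one_one_one : ∀ f₁ f₂ f₃ g₁ g₂ : ZMod 5, [f₁, f₂, f₃, g₁, g₂].Nodup → ∀ i,
    (∀ A ∈ [cycleArc i (i + 1), cycleArc (i + 1) i], f₁ ∈ A ∨ f₂ ∈ A ∨ g₁ ∈ A ∧ g₂ ∈ A) ∨
    (∀ A ∈ [cycleArc i (i + 2), cycleArc (i + 2) i], f₁ ∈ A ∨ f₃ ∈ A ∨ g₁ ∈ A ∧ g₂ ∈ A) ∨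
    (∀ A ∈ [cycleArc (i + 1) (i + 2), cycleArc (i + 2) (i + 1)],
      f₂ ∈ A ∨ f₃ ∈ A ∨ g₁ ∈ A ∧ g₂ ∈ A) := by
  decide +kernel

/-- The combinatorial core of the lower bound. Here `U` is the set of edges of the 5-cycle that
repeat a color of a bridge, `leaf e` is a leaf beyond the bridge with the color of `e`, attached at
`ρ (leaf e)`, and all edges outside `U` have the same color. -/
theorem false_of_cycleArcs {V : Type*} (U : Finset (ZMod 5)) (leaf : ZMod 5 → V) (ρ : V → ZMod 5)
    (n : ZMod 5 → ℕ)
    (h₀ : ∃ A ∈ [cycleArc 0 2, cycleArc 2 0], ∀ g ∈ A, ∀ g' ∈ A, g ∉ U → g' ∉ U → g = g')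
    (h₁ : ∀ e ∈ U, ∀ j, ∃ A ∈ [cycleArc (ρ (leaf e)) j, cycleArc j (ρ (leaf e))],
      (∀ g ∈ A, ∀ g' ∈ A, g ∉ U → g' ∉ U → g = g') ∧ ∀ e' ∈ U, leaf e' = leaf e → e' ∉ A)
    (h₂ : ∀ e ∈ U, ∀ e' ∈ U, ρ (leaf e) ≠ ρ (leaf e') →
      ∃ A ∈ [cycleArc (ρ (leaf e)) (ρ (leaf e')), cycleArc (ρ (leaf e')) (ρ (leaf e))],
        (∀ g ∈ A, ∀ g' ∈ A, g ∉ U → g' ∉ U → g = g') ∧ e ∉ A ∧ e' ∉ A)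
    (hn : Set.InjOn leaf U → ∀ j, {e ∈ U | ρ (leaf e) = j}.card ≤ n j)
    (hl : ∃ i, (n i ≤ 2 ∧ n (i + 2) ≤ 1 ∧ n (i + 1) = 0 ∧ n (i + 3) = 0 ∧ n (i + 4) = 0) ∨
      (n i ≤ 1 ∧ n (i + 1) ≤ 1 ∧ n (i + 2) ≤ 1 ∧ n (i + 3) = 0 ∧ n (i + 4) = 0)) : False := by
  have hinj : Set.InjOn leaf U := by
    intro e he e' he' heq
    by_contra hne
    obtain ⟨j, hj, hj'⟩ := exists_hit_cycleArcs (ρ (leaf e)) e e' hne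
    obtain ⟨A, hA, -, h⟩ := h₁ e he j
    have h1 := h e he rfl
    have h2 := h e' he' heq.symm
    simp only [List.mem_cons, List.not_mem_nil, or_false] at hA
    obtain rfl | rfl := hA <;> tauto
  specialize hn hinj
  obtain ⟨e, he⟩ : U.Nonempty := by
    rw [Finset.nonempty_iff_ne_empty]
    rintro rfl
    simp only [Finset.notMem_empty, not_false_eq_true, forall_const] at h₀
    revert h₀
    decide +kernel
  have hcompl : Uᶜ.card ≤ 2 := by
    by_contra! h
    obtain ⟨g₁, hg₁, g₂, hg₂, g₃, hg₃, h12, h13, h23⟩ := Finset.two_lt_card.1 h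
    rw [Finset.mem_compl] at hg₁ hg₂ hg₃
    have hge {g : ZMod 5} (hg : g ∉ U) : e ≠ g := fun h => hg (h ▸ he)
    obtain ⟨j, hj⟩ := exists_repeated_on_cycleArcs (ρ (leaf e)) e g₁ g₂ g₃ (hge hg₁) (hge hg₂)
      (hge hg₃) h12 h13 h23
    obtain ⟨A, hA, hP, he'⟩ := h₁ e he j
    obtain h | ⟨h, h'⟩ | ⟨h, h'⟩ | ⟨h, h'⟩ := hj A hA
    · exact he' e he rfl h
    · exact h12 (hP _ h _ h' hg₁ hg₂)
    · exact h13 (hP _ h _ h' hg₁ hg₃)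
    · exact h23 (hP _ h _ h' hg₂ hg₃)
  have hsum : U.card = ∑ j, {e ∈ U | ρ (leaf e) = j}.card :=
    Finset.card_eq_sum_card_fiberwise fun _ _ => Finset.mem_coe.2 (Finset.mem_univ _)
  have hU := Finset.card_add_card_compl U
  rw [ZMod.card] at hU
  have hsum' (i : ZMod 5) (f : ZMod 5 → ℕ) :
      ∑ j, f j = f i + f (i + 1) + f (i + 2) + f (i + 3) + f (i + 4) := by
    rw [← Equiv.sum_comp (Equiv.addLeft i) f]
    exact (Fin.sum_univ_five fun j : ZMod 5 => f (i + j)).trans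
      (congrArg (fun a => f a + f (i + 1) + f (i + 2) + f (i + 3) + f (i + 4)) (add_zero i))
  obtain ⟨i, hi⟩ := hl
  rw [hsum' i] at hsum
  have hn0 := hn i
  have hn1 := hn (i + 1)
  have hn2 := hn (i + 2)
  have hn3 := hn (i + 3)
  have hn4 := hn (i + 4)
  obtain ⟨g₁, g₂, hg, hgU⟩ := Finset.card_eq_two.1 (show Uᶜ.card = 2 by omega)
  have hg₁ : g₁ ∉ U := by rw [← Finset.mem_compl, hgU]; simp
  have hg₂ : g₂ ∉ U := by rw [← Finset.mem_compl, hgU]; simp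
  have hpair {a b : ZMod 5} {f f' : ZMod 5} (hf : f ∈ U ∧ ρ (leaf f) = a)
      (hf' : f' ∈ U ∧ ρ (leaf f') = b) (hab : a ≠ b) :
      ¬ ∀ A ∈ [cycleArc a b, cycleArc b a], f ∈ A ∨ f' ∈ A ∨ g₁ ∈ A ∧ g₂ ∈ A := by
    intro h
    obtain ⟨hfU, rfl⟩ := hf
    obtain ⟨hfU', rfl⟩ := hf'
    obtain ⟨A, hA, hP, h1, h2⟩ := h₂ f hfU f' hfU' hab
    obtain h | h | ⟨h, h'⟩ := h A hA
    exacts [h1 h, h2 h, hg (hP _ h _ h' hg₁ hg₂)]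
  have hnodup {f₁ f₂ f₃ : ZMod 5} (h1 : f₁ ∈ U) (h2 : f₂ ∈ U) (h3 : f₃ ∈ U) (h12 : f₁ ≠ f₂)
      (h13 : f₁ ≠ f₃) (h23 : f₂ ≠ f₃) : [f₁, f₂, f₃, g₁, g₂].Nodup := by
    have h {f g : ZMod 5} (hf : f ∈ U) (hg : g ∉ U) : f ≠ g := fun h => hg (h ▸ hf)
    simp [h12, h13, h23, hg, h h1 hg₁, h h1 hg₂, h h2 hg₁, h h2 hg₂, h h3 hg₁, h h3 hg₂]
  have hi01 : i ≠ i + 1 := by clear * -; revert i; decide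
  have hi02 : i ≠ i + 2 := by clear * -; revert i; decide
  have hi12 : i + 1 ≠ i + 2 := by clear * -; revert i; decide
  have hne {f f' : ZMod 5} {a b : ZMod 5} (hf : f ∈ U ∧ ρ (leaf f) = a)
      (hf' : f' ∈ U ∧ ρ (leaf f') = b) (hab : a ≠ b) : f ≠ f' := by
    rintro rfl
    exact hab (hf.2.symm.trans hf'.2)
  obtain hi | hi := hi
  · obtain ⟨f₁, f₂, h12, hF⟩ := Finset.card_eq_two.1
      (show {e ∈ U | ρ (leaf e) = i}.card = 2 by omega)
    obtain ⟨f₃, hF'⟩ := Finset.card_eq_one.1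
      (show {e ∈ U | ρ (leaf e) = i + 2}.card = 1 by omega)
    have hf₁ := Finset.mem_filter.1 (hF ▸ (by simp : f₁ ∈ ({f₁, f₂} : Finset (ZMod 5))))
    have hf₂ := Finset.mem_filter.1 (hF ▸ (by simp : f₂ ∈ ({f₁, f₂} : Finset (ZMod 5))))
    have hf₃ := Finset.mem_filter.1 (hF' ▸ Finset.mem_singleton_self f₃)
    obtain h | h := cycleArcs_of_two_one f₁ f₂ f₃ g₁ g₂
      (hnodup hf₁.1 hf₂.1 hf₃.1 h12 (hne hf₁ hf₃ hi02) (hne hf₂ hf₃ hi02)) i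
    exacts [hpair hf₁ hf₃ hi02 h, hpair hf₂ hf₃ hi02 h]
  · obtain ⟨f₁, hF₁⟩ := Finset.card_eq_one.1
      (show {e ∈ U | ρ (leaf e) = i}.card = 1 by omega)
    obtain ⟨f₂, hF₂⟩ := Finset.card_eq_one.1
      (show {e ∈ U | ρ (leaf e) = i + 1}.card = 1 by omega)
    obtain ⟨f₃, hF₃⟩ := Finset.card_eq_one.1
      (show {e ∈ U | ρ (leaf e) = i + 2}.card = 1 by omega)
    have hf₁ := Finset.mem_filter.1 (hF₁ ▸ Finset.mem_singleton_self f₁)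
    have hf₂ := Finset.mem_filter.1 (hF₂ ▸ Finset.mem_singleton_self f₂)
    have hf₃ := Finset.mem_filter.1 (hF₃ ▸ Finset.mem_singleton_self f₃)
    obtain h | h | h := cycleArcs_of_one_one_one f₁ f₂ f₃ g₁ g₂
      (hnodup hf₁.1 hf₂.1 hf₃.1 (hne hf₁ hf₂ hi01) (hne hf₁ hf₃ hi02) (hne hf₂ hf₃ hi12)) i
    exacts [hpair hf₁ hf₂ hi01 h, hpair hf₁ hf₃ hi02 h, hpair hf₂ hf₃ hi12 h]

/-- A rainbow coloring of a unicyclic graph of girth 5 with few leaves uses at least two colors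
besides those of the bridges. -/
theorem ncard_edgeSet_le_of_isRainbowConnected {V : Type*} [Fintype V] {G : SimpleGraph V}
    (hconn : G.Connected) {v : ZMod 5 → V} (hinj : Function.Injective v)
    (hadj : ∀ i, G.Adj (v i) (v (i + 1)))
    {r : V → ZMod 5} (hr : ∀ x j, (G.deleteEdges (cycleEdges v)).Reachable (v j) x ↔ r x = j)
    (hH : (G.deleteEdges (cycleEdges v)).IsAcyclic)
    (hl : ∃ i : ZMod 5,
      (numLeaves G v i ≤ 2 ∧ numLeaves G v (i + 2) ≤ 1 ∧
        numLeaves G v (i + 1) = 0 ∧ numLeaves G v (i + 3) = 0 ∧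
        numLeaves G v (i + 4) = 0) ∨
      (numLeaves G v i ≤ 1 ∧ numLeaves G v (i + 1) ≤ 1 ∧
        numLeaves G v (i + 2) ≤ 1 ∧ numLeaves G v (i + 3) = 0 ∧
        numLeaves G v (i + 4) = 0))
    {k : ℕ} {c : Sym2 V → Fin k} (hc : IsRainbowConnected G c) :
    G.edgeSet.ncard ≤ k + 3 := by
  classical
  by_contra! hk
  have hcard := ncard_edgeSet_deleteEdges_cycleEdges hinj hadj
  set H := G.deleteEdges (cycleEdges v) with hHdef
  have hHG : H.edgeSet ⊆ G.edgeSet := edgeSet_mono (G.deleteEdges_le _)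
  have hrv (j : ZMod 5) : r (v j) = j := (hr _ _).1 .rfl
  have hrainbow {x y : V} {p : G.Walk x y} (hp : (p.edges.map c).Nodup) {e e' : Sym2 V}
      (he : e ∈ p.edges) (he' : e' ∈ p.edges) (h : c e = c e') : e = e' :=
    List.inj_on_of_nodup_map hp he he' h
  have hcinj : Set.InjOn c H.edgeSet := by
    intro b hb b' hb' h
    by_contra hne
    obtain ⟨u, w, huw⟩ := hconn.exists_forall_walk_mem_edges (hHG hb) (hHG hb') hne
      (isBridge_of_mem_edgeSet hr hH hb) (isBridge_of_mem_edgeSet hr hH hb')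
    obtain ⟨p, -, hp⟩ := hc u w
    exact hne (hrainbow hp (huw p).1 (huw p).2 h)
  have hnew {y y' : Fin k} (hy : y ∉ c '' H.edgeSet) (hy' : y' ∉ c '' H.edgeSet) : y = y' := by
    have h1 := Set.ncard_add_ncard_compl (c '' H.edgeSet)
    rw [hcinj.ncard_image, Nat.card_fin] at h1
    have h2 : (c '' H.edgeSet)ᶜ.ncard ≤ 1 := by omega
    exact (Set.ncard_le_one (Set.toFinite _)).1 h2 y hy y' hy'
  let U : Finset (ZMod 5) := {e | c s(v e, v (e + 1)) ∈ c '' H.edgeSet}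
  have hleaf (e : ZMod 5) : ∃ z, e ∈ U → z ≠ v (r z) ∧ (H.neighborSet z).ncard = 1 ∧
      ∀ y, (y = v (r z) ∨ r y ≠ r z) → ∀ p : G.Walk z y, (p.edges.map c).Nodup →
        s(v e, v (e + 1)) ∉ p.edges := by
    by_cases he : e ∈ U
    · obtain ⟨b, hb, hbe⟩ := (Finset.mem_filter.1 he).2
      obtain ⟨z, hz, hz', hbz⟩ := exists_leaf hr hH hb
      refine ⟨z, fun _ => ⟨hz, hz', fun y hy p hp hep => ?_⟩⟩
      have := hrainbow hp (mem_edges_of_not_reachable hr p hbz hy) hep hbe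
      rw [this, hHdef, edgeSet_deleteEdges] at hb
      exact hb.2 (mem_cycleEdges v e)
    · exact ⟨v 0, fun h => (he h).elim⟩
  choose leaf hleaf using hleaf
  have harc {x y : V} {p : G.Walk x y} (hp : (p.edges.map c).Nodup) {A : Finset (ZMod 5)}
      (hA : ∀ k ∈ A, s(v k, v (k + 1)) ∈ p.edges) :
      ∀ g ∈ A, ∀ g' ∈ A, g ∉ U → g' ∉ U → g = g' := by
    intro g hg g' hg' hgU hgU'
    refine cycleEdge_injective hinj (hrainbow hp (hA g hg) (hA g' hg') (hnew ?_ ?_))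
    · simpa [U] using hgU
    · simpa [U] using hgU'
  refine false_of_cycleArcs U leaf r (numLeaves G v) ?_ ?_ ?_ ?_ hl
  · obtain ⟨p, -, hp⟩ := hc (v 0) (v 2)
    obtain ⟨A, hA, hAp⟩ := p.exists_cycleArc hr
    rw [hrv, hrv] at hA
    exact ⟨A, by simpa using hA, harc hp hAp⟩
  · intro e he j
    obtain ⟨p, -, hp⟩ := hc (leaf e) (v j)
    obtain ⟨A, hA, hAp⟩ := p.exists_cycleArc hr
    rw [hrv] at hA
    refine ⟨A, by simpa using hA, harc hp hAp, fun e' he' hee' heA => ?_⟩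
    obtain ⟨-, -, h⟩ := hleaf e' he'
    rw [hee'] at h
    refine h (v j) ?_ p hp (hAp e' heA)
    rw [hrv]
    by_cases hj : j = r (leaf e)
    exacts [.inl (hj ▸ rfl), .inr hj]
  · intro e he e' he' hne
    obtain ⟨p, -, hp⟩ := hc (leaf e) (leaf e')
    obtain ⟨A, hA, hAp⟩ := p.exists_cycleArc hr
    refine ⟨A, by simpa using hA, harc hp hAp, fun heA => ?_, fun heA => ?_⟩
    · exact (hleaf e he).2.2 _ (.inr hne.symm) p hp (hAp e heA)
    · refine (hleaf e' he').2.2 _ (.inr hne) p.reverse ?_ (by simpa using hAp e' heA)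
      simpa [List.map_reverse] using hp
  · intro hinjU j
    rw [← Finset.card_image_of_injOn (hinjU.mono (Finset.coe_subset.2 (Finset.filter_subset _ _))),
      ← Set.ncard_coe_finset]
    refine Set.ncard_le_ncard ?_ (Set.toFinite _)
    intro z hz
    obtain ⟨e, he, rfl⟩ := Finset.mem_image.1 (Finset.mem_coe.1 hz)
    obtain ⟨heU, rfl⟩ := Finset.mem_filter.1 he
    obtain ⟨h1, h2, -⟩ := hleaf e heU
    exact ⟨h1, (hr _ _).2 rfl, h2⟩

/-- Let `G` be a connected unicyclic graph with m edges whose unique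
cycle `v₁v₂v₃v₄v₅v₁` has length 5, with `G` not isomorphic to the cycle `C₅`.
If for some index `i` (mod 5), either `l(vᵢ) ≤ 2`, `l(v_{i+2}) ≤ 1` and
`l(v_{i+1}) = l(v_{i+3}) = l(v_{i+4}) = 0`, or `l(vᵢ) ≤ 1`, `l(v_{i+1}) ≤ 1`,
`l(v_{i+2}) ≤ 1` and `l(v_{i+3}) = l(v_{i+4}) = 0`, then rc(G) = m − 3. -/
theorem stmt_13 {V : Type*} [Fintype V] (G : SimpleGraph V)
    (hconn : G.Connected) (huni : G.edgeSet.ncard = Fintype.card V)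
    (v : ZMod 5 → V) (hinj : Function.Injective v)
    (hadj : ∀ i : ZMod 5, G.Adj (v i) (v (i + 1)))
    (hC5 : ¬ Nonempty (G ≃g SimpleGraph.cycleGraph 5))
    (hl : ∃ i : ZMod 5,
      (numLeaves G v i ≤ 2 ∧ numLeaves G v (i + 2) ≤ 1 ∧
        numLeaves G v (i + 1) = 0 ∧ numLeaves G v (i + 3) = 0 ∧
        numLeaves G v (i + 4) = 0) ∨
      (numLeaves G v i ≤ 1 ∧ numLeaves G v (i + 1) ≤ 1 ∧
        numLeaves G v (i + 2) ≤ 1 ∧ numLeaves G v (i + 3) = 0 ∧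
        numLeaves G v (i + 4) = 0)) :
    rc G = G.edgeSet.ncard - 3 := by
  obtain ⟨hH, r, hr⟩ := exists_root hconn huni hinj hadj
  have hcard := ncard_edgeSet_deleteEdges_cycleEdges hinj hadj
  have hne : (G.deleteEdges (cycleEdges v)).edgeSet.Nonempty := by
    rw [Set.nonempty_iff_ne_empty]
    exact fun h => hC5 (nonempty_iso_cycleGraph_of_edgeSet_eq_empty hinj hadj hr h)
  obtain ⟨b, hb⟩ := hne
  obtain ⟨c, hc⟩ := exists_isRainbowConnected hinj hadj hr ⟨b, hb⟩
  have hmem : G.edgeSet.ncard - 3 ∈ {k : ℕ | ∃ c : Sym2 V → Fin k, IsRainbowConnected G c} := by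
    have hα : Nat.card ((G.deleteEdges (cycleEdges v)).edgeSet ⊕ Bool) =
        G.edgeSet.ncard - 3 := by
      rw [Nat.card_sum, Nat.card_coe_set_eq, Nat.card_eq_fintype_card (α := Bool),
        Fintype.card_bool]
      omega
    refine ⟨Finite.equivFinOfCardEq hα ∘ c, fun u w => ?_⟩
    obtain ⟨p, hp, hpc⟩ := hc u w
    refine ⟨p, hp, ?_⟩
    rw [← List.map_map]
    exact hpc.map (Equiv.injective _)
  refine le_antisymm (Nat.sInf_le hmem) (le_csInf ⟨_, hmem⟩ ?_)
  rintro k ⟨c, hc⟩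
  have := ncard_edgeSet_le_of_isRainbowConnected hconn hinj hadj hr hH hl hc
  omega
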